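/- Let p ∈ (0,2], let d ≥ 1 be a real number, let B₀ ≥ B_∞ > 0, let c₁, C > 0, let K₀ ∈ [1/B₀, 2/B₀], and let V_∞ ∈ ℝ. Then there exist constants A₋ > 0 (one may take A₋ = c₁ e^{−B₀}), A₊ > 0 and γ₀ ∈ (0,1) such that the following holds for every γ ∈ (0,γ₀), with t₀ = K₀|ln γ|. Let Q : [0,∞) → ℝ be continuous with B_∞ ≤ Q(t) ≤ B₀ for all t, and let R : [0,∞) → ℝ be continuous with R(t) ≥ c₁ γ^{p+1} t^{−(p+d)} χ{t ≥ t₀} (so in particular R(t) ≥ 0) and R(t) ≤ C (γ + γ^{p+1} A₊)^{p+1} (1+t)^{−(p+d)} for all t ≥ 0. Define V(t) = V_∞ + γ e^{−∫_0^t Q(r)dr} − ∫_0^t e^{−∫_s^t Q(r)dr} R(s) ds, which is the solution of dV/dt = Q(t)(V_∞ − V) − R(t) with V(0) = V_∞ + γ. Then for all t ≥ 0: γ e^{−B₀ t} − A₊ γ^{p+1} (1+t)^{−(p+d)} ≤ V(t) − V_∞ ≤ γ e^{−B_∞ t} − A₋ γ^{p+1} t^{−(p+d)} χ{t ≥ t₀+1};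 in particular the velocity reverses, i.e. V(t) < V_∞ for all sufficiently large t. -/

import Mathlib

open MeasureTheory Real Set

lemma aux_int_bounds {Q : ℝ → ℝ} {a b : ℝ} (hQ : ContinuousOn Q (Set.Ici 0))
    (hb : ∀ t ≥ (0:ℝ), a ≤ Q t ∧ Q t ≤ b) {s t : ℝ} (hs : 0 ≤ s) (hst : s ≤ t) :
    a * (t - s) ≤ (∫ r in s..t, Q r) ∧ (∫ r in s..t, Q r) ≤ b * (t - s) := by
  have hi : IntervalIntegrable Q volume s t := by
    apply ContinuousOn.intervalIntegrable_of_Icc hst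
    exact hQ.mono (fun x hx => le_trans hs hx.1)
  constructor
  · have := intervalIntegral.integral_mono_on hst (intervalIntegrable_const (c := a)) hi
      (fun x hx => (hb x (le_trans hs hx.1)).1)
    simp at this
    linarith
  · have := intervalIntegral.integral_mono_on hst hi (intervalIntegrable_const (c := b))
      (fun x hx => (hb x (le_trans hs hx.1)).2)
    simp at this
    linarith

lemma aux_cont {Q R : ℝ → ℝ} (hQ : ContinuousOn Q (Set.Ici 0))
    (hR : ContinuousOn R (Set.Ici 0)) (t : ℝ) (ht : 0 ≤ t) :
    ContinuousOn (fun s => Real.exp (-(∫ r in s..t, Q r)) * R s) (Set.Icc 0 t) := by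
  have hQ' : Continuous (fun s => Q (max s 0)) := by
    apply hQ.comp_continuous (by fun_prop)
    intro x; simp
  have h1 : Continuous (fun s => ∫ r in t..s, Q (max r 0)) :=
    intervalIntegral.continuous_primitive (fun a b => hQ'.intervalIntegrable a b) t
  have h2 : ContinuousOn (fun s => ∫ r in s..t, Q r) (Set.Icc 0 t) := by
    apply (h1.neg.continuousOn).congr
    intro s hs
    simp only [Pi.neg_apply]
    rw [← intervalIntegral.integral_symm]
    apply intervalIntegral.integral_congr
    intro r hr
    rw [Set.uIcc_of_le hs.2] at hr
    simp only
    rw [max_eq_left (le_trans hs.1 hr.1)]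
  exact (h2.neg.rexp).mul (hR.mono (fun x hx => hx.1))

lemma aux_growth {B q : ℝ} (hB : 0 < B) (hq : 0 < q) {u : ℝ} (hu : 0 ≤ u) :
    (1 + u) ^ q ≤ (2 * q / B) ^ q * Real.exp (B / 2) * Real.exp (B / 2 * u) := by
  have h1 : 1 + u ≤ (2 * q / B) * Real.exp (B / (2 * q) * (1 + u)) := by
    have h := Real.add_one_le_exp (B / (2 * q) * (1 + u))
    have : 1 + u = (2 * q / B) * (B / (2 * q) * (1 + u)) := by field_simp
    calc 1 + u = (2 * q / B) * (B / (2 * q) * (1 + u)) := this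
      _ ≤ _ := by
        apply mul_le_mul_of_nonneg_left _ (by positivity)
        linarith
  calc (1 + u) ^ q ≤ ((2 * q / B) * Real.exp (B / (2 * q) * (1 + u))) ^ q :=
        Real.rpow_le_rpow (by linarith) h1 hq.le
    _ = (2 * q / B) ^ q * Real.exp (B / 2) * Real.exp (B / 2 * u) := by
        rw [Real.mul_rpow (by positivity) (by positivity), ← Real.exp_mul,
          mul_assoc ((2 * q / B) ^ q), ← Real.exp_add]
        congr 2
        field_simp

lemma aux_weight {B q : ℝ} (hB : 0 < B) (hq : 0 < q) {s t : ℝ} (hs : 0 ≤ s) (hst : s ≤ t) :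
    Real.exp (-(B * (t - s))) * (1 + s) ^ (-q) ≤
      (2 * q / B) ^ q * Real.exp (B / 2) * (1 + t) ^ (-q) * Real.exp (-(B / 2 * (t - s))) := by
  have hu : 0 ≤ t - s := by linarith
  have h1 := aux_growth hB hq hu
  have h2 : (1 + t) ^ q ≤ (1 + s) ^ q * (1 + (t - s)) ^ q := by
    rw [← Real.mul_rpow (by linarith) (by linarith)]
    apply Real.rpow_le_rpow (by linarith) _ hq.le
    nlinarith [mul_nonneg hs hu]
  have hs' : 0 < (1 + s) ^ q := Real.rpow_pos_of_pos (by linarith) _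
  have ht' : 0 < (1 + t) ^ q := Real.rpow_pos_of_pos (by linarith) _
  rw [Real.rpow_neg (by linarith), Real.rpow_neg (by linarith)]
  have h3 : ((1 + s) ^ q)⁻¹ ≤ (1 + (t - s)) ^ q * ((1 + t) ^ q)⁻¹ := by
    rw [← div_eq_mul_inv, le_div_iff₀ ht', inv_mul_le_iff₀ hs']
    exact h2
  have h4 : Real.exp (-(B / 2 * (t - s))) =
      Real.exp (-(B * (t - s))) * Real.exp (B / 2 * (t - s)) := by
    rw [← Real.exp_add]; congr 1; ring
  rw [h4]
  calc _ ≤ Real.exp (-(B * (t - s))) * ((1 + (t - s)) ^ q * ((1 + t) ^ q)⁻¹) := by gcongr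
    _ ≤ Real.exp (-(B * (t - s))) * (((2 * q / B) ^ q * Real.exp (B / 2) *
          Real.exp (B / 2 * (t - s))) * ((1 + t) ^ q)⁻¹) := by gcongr
    _ = _ := by ring

lemma aux_exp_int {b t : ℝ} (hb : 0 < b) :
    (∫ s in (0:ℝ)..t, Real.exp (-(b * (t - s)))) ≤ 1 / b := by
  have h : ∀ s ∈ Set.uIcc 0 t, HasDerivAt (fun s => Real.exp (-(b * (t - s))) / b)
      (Real.exp (-(b * (t - s)))) s := by
    intro s _
    have h1 : HasDerivAt (fun s => -(b * (t - s))) b s := by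
      have h0 : HasDerivAt (fun s : ℝ => b * s - b * t) b s := by
        simpa using ((hasDerivAt_id s).const_mul b).sub_const (b * t)
      have e : (fun s => -(b * (t - s))) = fun s : ℝ => b * s - b * t := by
        funext s; ring
      rw [e]; exact h0
    have := h1.exp.div_const b
    rwa [mul_div_cancel_right₀ _ hb.ne'] at this
  rw [intervalIntegral.integral_eq_sub_of_hasDerivAt h
    (Continuous.intervalIntegrable (by fun_prop) _ _)]
  simp
  positivity

/-- the Duhamel iteration estimate in the reversal case, with t₀ = K₀|ln γ|.
The new motion V generated by the iteration map stays in the reversal class; in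
particular the velocity reverses: V(t) < V_∞ for all sufficiently large t. -/
theorem iteration_reversal (p d B₀ Binf c₁ C K₀ Vinf : ℝ)
    (hp : 0 < p) (hp2 : p ≤ 2) (hd : 1 ≤ d)
    (hBB : Binf ≤ B₀) (hBinf : 0 < Binf) (hc₁ : 0 < c₁) (hC : 0 < C)
    (hK₀ : K₀ ∈ Set.Icc (1 / B₀) (2 / B₀)) :
    ∃ Am > (0:ℝ), Am = c₁ * Real.exp (-B₀) ∧ ∃ Ap > (0:ℝ), ∃ γ₀ ∈ Set.Ioo (0:ℝ) 1,
      ∀ γ ∈ Set.Ioo (0:ℝ) γ₀, ∀ Q R V : ℝ → ℝ,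
      ContinuousOn Q (Set.Ici 0) → ContinuousOn R (Set.Ici 0) →
      (∀ t ≥ (0:ℝ), Binf ≤ Q t ∧ Q t ≤ B₀) →
      (∀ t ≥ (0:ℝ),
        (if K₀ * |Real.log γ| ≤ t then c₁ * γ ^ (p + 1) * t ^ (-(p + d)) else 0) ≤ R t) →
      (∀ t ≥ (0:ℝ),
        R t ≤ C * (γ + γ ^ (p + 1) * Ap) ^ (p + 1) * (1 + t) ^ (-(p + d))) →
      (∀ t : ℝ, V t = Vinf + γ * Real.exp (-(∫ r in (0:ℝ)..t, Q r))
          - ∫ s in (0:ℝ)..t, Real.exp (-(∫ r in s..t, Q r)) * R s) →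
      (∀ t ≥ (0:ℝ),
        (γ * Real.exp (-B₀ * t) - Ap * γ ^ (p + 1) * (1 + t) ^ (-(p + d)) ≤ V t - Vinf) ∧
        (V t - Vinf ≤ γ * Real.exp (-Binf * t)
            - (if K₀ * |Real.log γ| + 1 ≤ t then Am * γ ^ (p + 1) * t ^ (-(p + d)) else 0))) ∧
      (∃ T : ℝ, ∀ t ≥ T, V t < Vinf) := by
  have hB₀ : 0 < B₀ := lt_of_lt_of_le hBinf hBB
  have hq : 0 < p + d := by linarith
  have hK : 0 < K₀ := lt_of_lt_of_le (by positivity) hK₀.1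
  set q := p + d with hqdef
  set D := (2 * q / Binf) ^ q * Real.exp (Binf / 2) with hD
  have hDpos : 0 < D := by positivity
  set L := D * (1 / (Binf / 2)) with hL
  have hLpos : 0 < L := by positivity
  refine ⟨c₁ * Real.exp (-B₀), by positivity, rfl, C * L * 2 ^ (p + 1), by positivity, ?_⟩
  set Ap := C * L * 2 ^ (p + 1) with hAp
  have hAppos : 0 < Ap := by positivity
  refine ⟨min (1 / 2) ((1 / Ap) ^ (1 / p)), ⟨by positivity, ?_⟩, ?_⟩
  · exact lt_of_le_of_lt (min_le_left _ _) (by norm_num)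
  intro γ hγ Q R V hQ hR hQb hRl hRu hV
  have hγ0 : 0 < γ := hγ.1
  have hγ1 : γ < 1 := lt_of_lt_of_le hγ.2 (le_trans (min_le_left _ _) (by norm_num))
  have hγp : γ ^ p * Ap ≤ 1 := by
    have h1 : γ ^ p ≤ ((1 / Ap) ^ (1 / p)) ^ p :=
      Real.rpow_le_rpow hγ0.le (hγ.2.le.trans (min_le_right _ _)) hp.le
    rw [← Real.rpow_mul (by positivity), one_div_mul_cancel hp.ne', Real.rpow_one,
      le_div_iff₀ hAppos] at h1
    exact h1
  have hM : C * (γ + γ ^ (p + 1) * Ap) ^ (p + 1) * L ≤ Ap * γ ^ (p + 1) := by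
    have e : γ + γ ^ (p + 1) * Ap = γ * (1 + γ ^ p * Ap) := by
      rw [Real.rpow_add hγ0, Real.rpow_one]; ring
    rw [e, Real.mul_rpow hγ0.le (by positivity)]
    have : (1 + γ ^ p * Ap) ^ (p + 1) ≤ 2 ^ (p + 1) :=
      Real.rpow_le_rpow (by positivity) (by linarith) (by linarith)
    calc C * (γ ^ (p + 1) * (1 + γ ^ p * Ap) ^ (p + 1)) * L
        ≤ C * (γ ^ (p + 1) * 2 ^ (p + 1)) * L := by gcongr
      _ = Ap * γ ^ (p + 1) := by rw [hAp]; ring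
  set M := C * (γ + γ ^ (p + 1) * Ap) ^ (p + 1) with hMdef
  have hMpos : 0 < M := by positivity
  have ht₀ : 0 < K₀ * |Real.log γ| := by
    have : Real.log γ < 0 := Real.log_neg hγ0 hγ1
    have := abs_pos.mpr this.ne
    positivity
  set t₀ := K₀ * |Real.log γ| with ht₀def
  have hR0 : ∀ t ≥ (0:ℝ), 0 ≤ R t := by
    intro t ht
    refine le_trans ?_ (hRl t ht)
    split_ifs <;> positivity
  have main : ∀ t ≥ (0:ℝ),
        (γ * Real.exp (-B₀ * t) - Ap * γ ^ (p + 1) * (1 + t) ^ (-q) ≤ V t - Vinf) ∧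
        (V t - Vinf ≤ γ * Real.exp (-Binf * t)
            - (if t₀ + 1 ≤ t then c₁ * Real.exp (-B₀) * γ ^ (p + 1) * t ^ (-q) else 0)) := by
    intro t ht
    have hk := aux_cont hQ hR t ht
    have hki : ∀ a b, 0 ≤ a → a ≤ b → b ≤ t → IntervalIntegrable
        (fun s => Real.exp (-(∫ r in s..t, Q r)) * R s) volume a b := by
      intro a b ha hab hb
      exact (hk.mono (Set.Icc_subset_Icc ha hb)).intervalIntegrable_of_Icc hab
    have hQt := aux_int_bounds hQ hQb le_rfl ht
    rw [sub_zero] at hQt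
    rw [hV t]
    constructor
    · have h1 : γ * Real.exp (-B₀ * t) ≤ γ * Real.exp (-(∫ r in (0:ℝ)..t, Q r)) := by
        gcongr
        linarith [hQt.2]
      have h2 : (∫ s in (0:ℝ)..t, Real.exp (-(∫ r in s..t, Q r)) * R s) ≤
          ∫ s in (0:ℝ)..t, (M * D * (1 + t) ^ (-q)) * Real.exp (-(Binf / 2 * (t - s))) := by
        apply intervalIntegral.integral_mono_on ht (hki 0 t le_rfl ht le_rfl)
          (Continuous.intervalIntegrable (by fun_prop) _ _)
        intro s hs
        have hw := aux_weight hBinf hq hs.1 hs.2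
        have hb := (aux_int_bounds hQ hQb hs.1 hs.2).1
        calc Real.exp (-(∫ r in s..t, Q r)) * R s
            ≤ Real.exp (-(Binf * (t - s))) * (M * (1 + s) ^ (-q)) := by
              apply mul_le_mul _ (hRu s hs.1) (hR0 s hs.1) (Real.exp_pos _).le
              exact Real.exp_le_exp.mpr (by linarith)
          _ = M * (Real.exp (-(Binf * (t - s))) * (1 + s) ^ (-q)) := by ring
          _ ≤ M * (D * (1 + t) ^ (-q) * Real.exp (-(Binf / 2 * (t - s)))) := by gcongr
          _ = _ := by ring
      rw [intervalIntegral.integral_const_mul] at h2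
      have h3 := aux_exp_int (b := Binf / 2) (t := t) (by positivity)
      have hpos : 0 < (1 + t) ^ (-q) := Real.rpow_pos_of_pos (by linarith) _
      have h4 : (M * D * (1 + t) ^ (-q)) * (∫ s in (0:ℝ)..t, Real.exp (-(Binf / 2 * (t - s))))
          ≤ Ap * γ ^ (p + 1) * (1 + t) ^ (-q) := by
        calc _ ≤ (M * D * (1 + t) ^ (-q)) * (1 / (Binf / 2)) := by gcongr
          _ = (M * L) * (1 + t) ^ (-q) := by rw [hL]; ring
          _ ≤ _ := by gcongr
      linarith
    · have h1 : γ * Real.exp (-(∫ r in (0:ℝ)..t, Q r)) ≤ γ * Real.exp (-Binf * t) := by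
        gcongr
        linarith [hQt.1]
      have h2 : (if t₀ + 1 ≤ t then c₁ * Real.exp (-B₀) * γ ^ (p + 1) * t ^ (-q) else 0) ≤
          ∫ s in (0:ℝ)..t, Real.exp (-(∫ r in s..t, Q r)) * R s := by
        have hnn : ∀ s, 0 ≤ s → 0 ≤ Real.exp (-(∫ r in s..t, Q r)) * R s :=
          fun s hs => mul_nonneg (Real.exp_pos _).le (hR0 s hs)
        split_ifs with h
        · have ht1 : 0 ≤ t - 1 := by linarith
          rw [← intervalIntegral.integral_add_adjacent_intervals
            (hki 0 (t - 1) le_rfl ht1 (by linarith)) (hki (t - 1) t ht1 (by linarith) le_rfl)]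
          have ha : 0 ≤ ∫ s in (0:ℝ)..(t - 1), Real.exp (-(∫ r in s..t, Q r)) * R s :=
            intervalIntegral.integral_nonneg ht1 (fun s hs => hnn s hs.1)
          have hb := intervalIntegral.integral_mono_on (by linarith : t - 1 ≤ t)
            (intervalIntegrable_const (c := c₁ * Real.exp (-B₀) * γ ^ (p + 1) * t ^ (-q)))
            (hki (t - 1) t ht1 (by linarith) le_rfl) (by
              intro s hs
              have hs0 : 0 < s := by linarith [hs.1]
              have hl := hRl s hs0.le
              rw [if_pos (by linarith [hs.1])] at hl
              have hb := (aux_int_bounds hQ hQb hs0.le hs.2).2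
              have hpw : t ^ (-q) ≤ s ^ (-q) :=
                Real.rpow_le_rpow_of_nonpos hs0 hs.2 (by linarith)
              calc c₁ * Real.exp (-B₀) * γ ^ (p + 1) * t ^ (-q)
                  = Real.exp (-B₀) * (c₁ * γ ^ (p + 1) * t ^ (-q)) := by ring
                _ ≤ Real.exp (-B₀) * (c₁ * γ ^ (p + 1) * s ^ (-q)) := by gcongr
                _ ≤ Real.exp (-(∫ r in s..t, Q r)) * R s := by
                  apply mul_le_mul _ hl (by positivity) (Real.exp_pos _).le
                  apply Real.exp_le_exp.mpr
                  nlinarith [hs.1])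
          simp only [intervalIntegral.integral_const, smul_eq_mul] at hb
          linarith
        · exact intervalIntegral.integral_nonneg ht (fun s hs => hnn s hs.1)
      linarith
  refine ⟨main, ?_⟩
  have hlim := tendsto_rpow_mul_exp_neg_mul_atTop_nhds_zero q Binf hBinf
  have hε : 0 < c₁ * Real.exp (-B₀) * γ ^ p := by positivity
  obtain ⟨T, hT⟩ := Filter.eventually_atTop.mp (hlim.eventually (gt_mem_nhds hε))
  refine ⟨max T (t₀ + 1), fun t ht => ?_⟩
  have htT := hT t (le_trans (le_max_left _ _) ht)
  have htt : t₀ + 1 ≤ t := le_trans (le_max_right _ _) ht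
  have ht0 : 0 < t := by linarith
  have hm := (main t ht0.le).2
  rw [if_pos htt] at hm
  have htq : 0 < t ^ q := Real.rpow_pos_of_pos ht0 _
  have : γ * Real.exp (-Binf * t) < c₁ * Real.exp (-B₀) * γ ^ (p + 1) * t ^ (-q) := by
    rw [Real.rpow_neg ht0.le, ← div_eq_mul_inv, lt_div_iff₀ htq, Real.rpow_add hγ0,
      Real.rpow_one]
    nlinarith [mul_lt_mul_of_pos_left htT hγ0]
  linarith
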